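/- Let D be a database and Σ ∈ L a finite set of linear TGDs. Then: (1) Σ ∈ CT_D if and only if simple(Σ) ∈ CT_{simple(D)}; and (2) maxdepth(D,Σ) = maxdepth(simple(D), simple(Σ)). -/

import Mathlib

set_option maxHeartbeats 1000000

/-! ### Basic syntax: atoms, TGDs, terms -/

/-- An atom: a predicate name together with a list of arguments. -/
structure Atom (T : Type) where
  pred : ℕ
  args : List T
deriving DecidableEq

def Atom.map {T U : Type} (f : T → U) (a : Atom T) : Atom U :=
  ⟨a.pred, a.args.map f⟩

/-- The signature (predicate name, arity) of an atom. -/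
def Atom.sig {T : Type} (a : Atom T) : ℕ × ℕ := (a.pred, a.args.length)

def Atom.equivProd : Atom ℕ ≃ ℕ × List ℕ where
  toFun a := (a.pred, a.args)
  invFun p := ⟨p.1, p.2⟩
  left_inv a := rfl
  right_inv p := rfl

instance : Encodable (Atom ℕ) := Encodable.ofEquiv _ Atom.equivProd

/-- A tuple-generating dependency, given by its (non-empty) body and head,
whose atoms carry variables (natural numbers) as arguments. -/
structure TGD where
  body : List (Atom ℕ)
  head : List (Atom ℕ)
  body_ne : body ≠ []
  head_ne : head ≠ []

def atomVars (a : Atom ℕ) : Finset ℕ := a.args.toFinset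

def TGD.bodyVars (σ : TGD) : Finset ℕ := σ.body.foldr (fun a s => atomVars a ∪ s) ∅
def TGD.headVars (σ : TGD) : Finset ℕ := σ.head.foldr (fun a s => atomVars a ∪ s) ∅
/-- The frontier of a TGD: variables occurring both in the body and in the head. -/
def TGD.frontier (σ : TGD) : Finset ℕ := σ.bodyVars ∩ σ.headVars
/-- The existentially quantified variables: head variables not occurring in the body. -/
def TGD.exVars (σ : TGD) : Finset ℕ := σ.headVars \ σ.bodyVars

/-- Terms: constants, and labelled nulls `⊥^z_{σ,h}` determined by a TGD `σ`,
a substitution `h` (the restriction of the trigger homomorphism to the frontier)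
and a variable `z`. -/
inductive TermT : Type where
  | const : ℕ → TermT
  | null : TGD → (ℕ → TermT) → ℕ → TermT

/-- The depth of a term. -/
def TermT.depth : TermT → ℕ
  | .const _ => 0
  | .null σ h _ => 1 + σ.frontier.sup (fun x => (h x).depth)

/-- The depth of an atom: the maximal depth of its arguments. -/
def Atom.depth (a : Atom TermT) : ℕ := (a.args.map TermT.depth).foldr max 0

/-! ### The semi-oblivious chase -/

/-- Restriction of a substitution to the frontier of a TGD (with default value elsewhere). -/
def TGD.restrict (σ : TGD) (h : ℕ → TermT) : ℕ → TermT :=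
  fun x => if x ∈ σ.frontier then h x else .const 0

/-- The map `μ` sending each frontier variable `x` to `h x` and each other (existential)
variable `z` to the null `⊥^z_{σ,h|fr(σ)}`. -/
def TGD.mu (σ : TGD) (h : ℕ → TermT) : ℕ → TermT :=
  fun x => if x ∈ σ.frontier then h x else .null σ (σ.restrict h) x

/-- The result of the trigger `(σ,h)`. -/
def TGD.result (σ : TGD) (h : ℕ → TermT) : Set (Atom TermT) :=
  {a | ∃ b ∈ σ.head, a = b.map (σ.mu h)}

abbrev Database := Finset (Atom ℕ)
abbrev Instance := Set (Atom TermT)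

def dbInstance (D : Database) : Instance := (Atom.map TermT.const) '' ↑D

/-- `chase D S` (the result of any valid semi-oblivious chase derivation of `D` w.r.t. `S`),
defined as the least set of atoms containing `D` and closed under all triggers. -/
inductive InChase (D : Database) (S : Set TGD) : Atom TermT → Prop
  | db {a : Atom ℕ} : a ∈ D → InChase D S (a.map TermT.const)
  | step {σ : TGD} (hσ : σ ∈ S) (h : ℕ → TermT)
      (hb : ∀ b ∈ σ.body, InChase D S (b.map h))
      {a : Atom TermT} (ha : a ∈ σ.result h) : InChase D S a

def chase (D : Database) (S : Set TGD) : Instance := {a | InChase D S a}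

/-- The active domain of an instance: the set of terms occurring in it. -/
def adom (I : Instance) : Set TermT := {t | ∃ a ∈ I, t ∈ a.args}

/-- `Σ ∈ CT_D`: the chase of `D` w.r.t. `Σ` is finite. -/
def InCT (D : Database) (S : Set TGD) : Prop := (chase D S).Finite

open Classical in
/-- The maximal depth of a term occurring in `chase D S`, and `⊤` if the chase is infinite. -/
noncomputable def maxdepth (D : Database) (S : Set TGD) : ℕ∞ :=
  if (chase D S).Finite then ⨆ t ∈ adom (chase D S), (TermT.depth t : ℕ∞) else ⊤

/-! ### Schema, arity, classes of TGDs -/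

def TGD.atomsList (σ : TGD) : List (Atom ℕ) := σ.body ++ σ.head

/-- The schema of a set of TGDs: the (predicate name, arity) pairs occurring in it. -/
def sch (S : Set TGD) : Set (ℕ × ℕ) := {p | ∃ σ ∈ S, ∃ a ∈ σ.atomsList, a.sig = p}

/-- The maximal arity of a predicate of the schema. -/
noncomputable def arity (S : Set TGD) : ℕ := sSup ((fun p => p.2) '' sch S)

/-- The set of atoms occurring in the TGDs of `S`. -/
def atomsOf (S : Set TGD) : Set (Atom ℕ) := {a | ∃ σ ∈ S, a ∈ σ.atomsList}

/-- `‖Σ‖ = |atoms(Σ)| · |sch(Σ)| · ar(Σ)`. -/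
noncomputable def tgdNorm (S : Set TGD) : ℕ := (atomsOf S).ncard * (sch S).ncard * arity S

/-- A TGD is guarded if some body atom contains all body variables. -/
def TGD.Guarded (σ : TGD) : Prop := ∃ a ∈ σ.body, σ.bodyVars ⊆ atomVars a

/-- A TGD is linear if its body consists of a single atom. -/
def TGD.Linear (σ : TGD) : Prop := ∃ a, σ.body = [a]

/-- A TGD is simple linear if its body is a single atom without repeated variables. -/
def TGD.SimpleLinear (σ : TGD) : Prop := ∃ a, σ.body = [a] ∧ a.args.Nodup

/-- The guard of a TGD: the leftmost body atom containing all body variables. -/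
def TGD.guard (σ : TGD) : Atom ℕ :=
  (σ.body.find? (fun a => decide (σ.bodyVars ⊆ atomVars a))).getD ⟨0, []⟩

/-! ### Chase derivations and the guarded chase forest -/

def IsTrigger (S : Set TGD) (σ : TGD) (h : ℕ → TermT) (I : Instance) : Prop :=
  σ ∈ S ∧ ∀ b ∈ σ.body, b.map h ∈ I

def IsActive (S : Set TGD) (σ : TGD) (h : ℕ → TermT) (I : Instance) : Prop :=
  IsTrigger S σ h I ∧ ¬ σ.result h ⊆ I

/-- A chase derivation of `D` w.r.t. `S`: at each step either an active trigger is applied,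
or no active trigger exists and the instance stays put (the derivation has terminated). -/
structure ChaseDerivation (D : Database) (S : Set TGD) where
  inst : ℕ → Instance
  trig : ℕ → Option (TGD × (ℕ → TermT))
  init : inst 0 = dbInstance D
  step_some : ∀ i σ h, trig i = some (σ, h) →
    IsActive S σ h (inst i) ∧ inst (i + 1) = inst i ∪ σ.result h
  step_none : ∀ i, trig i = none →
    (∀ σ h, ¬ IsActive S σ h (inst i)) ∧ inst (i + 1) = inst i

/-- The derivation is finite: it eventually reaches an instance with no active trigger. -/
def ChaseDerivation.IsFiniteDer {D : Database} {S : Set TGD} (δ : ChaseDerivation D S) : Prop :=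
  ∃ i, δ.trig i = none

/-- Fairness: every active trigger eventually becomes non-active. -/
def ChaseDerivation.Fair {D : Database} {S : Set TGD} (δ : ChaseDerivation D S) : Prop :=
  ∀ i σ h, IsActive S σ h (δ.inst i) → ∃ j, i < j ∧ ¬ IsActive S σ h (δ.inst j)

def ChaseDerivation.Valid {D : Database} {S : Set TGD} (δ : ChaseDerivation D S) : Prop :=
  δ.IsFiniteDer ∨ δ.Fair

/-- The edge relation of the guarded chase forest of a derivation. -/
def gedge {D : Database} {S : Set TGD} (δ : ChaseDerivation D S) (α β : Atom TermT) : Prop :=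
  ∃ i σ h, δ.trig i = some (σ, h) ∧ α = (TGD.guard σ).map h ∧
    β ∈ δ.inst (i + 1) \ δ.inst i

/-- The tree of the guarded chase forest rooted at the database atom `α`. -/
def gtree {D : Database} {S : Set TGD} (δ : ChaseDerivation D S) (α : Atom ℕ) : Set (Atom TermT) :=
  {β | Relation.ReflTransGen (gedge δ) (α.map TermT.const) β}

/-- The atoms of depth `i` in the tree rooted at `α`. -/
def gtreeLevel {D : Database} {S : Set TGD} (δ : ChaseDerivation D S) (α : Atom ℕ) (i : ℕ) :
    Set (Atom TermT) :=
  {β ∈ gtree δ α | Atom.depth β = i}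

/-! ### Dependency graph, reachability and non-uniform weak-acyclicity -/

/-- A position `(R, i)` of a schema: a (predicate name, arity) pair and an argument index. -/
abbrev Pos := (ℕ × ℕ) × ℕ

def occursAt {T : Type} (x : T) (a : Atom T) (p : Pos) : Prop :=
  p.1 = a.sig ∧ a.args[p.2]? = some x

/-- Normal edges of the dependency graph. -/
def NormalEdge (S : Set TGD) (p q : Pos) : Prop :=
  ∃ σ ∈ S, ∃ x ∈ σ.frontier, (∃ a ∈ σ.body, occursAt x a p) ∧ (∃ b ∈ σ.head, occursAt x b q)

/-- Special edges of the dependency graph. -/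
def SpecialEdge (S : Set TGD) (p q : Pos) : Prop :=
  ∃ σ ∈ S, ∃ x ∈ σ.frontier, (∃ a ∈ σ.body, occursAt x a p) ∧
    (∃ z ∈ σ.exVars, ∃ b ∈ σ.head, occursAt z b q)

def predEdge (S : Set TGD) (R P : ℕ × ℕ) : Prop :=
  ∃ σ ∈ S, (∃ a ∈ σ.body, a.sig = R) ∧ (∃ b ∈ σ.head, b.sig = P)

/-- `R ⤳_Σ P`: predicate reachability. -/
def Reach (S : Set TGD) : (ℕ × ℕ) → (ℕ × ℕ) → Prop := Relation.ReflTransGen (predEdge S)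

/-- `Σ` is `D`-weakly-acyclic: no `D`-supported cycle of the dependency graph
contains a special edge. -/
def DWeaklyAcyclic (D : Database) (S : Set TGD) : Prop :=
  ¬ ∃ (n : ℕ) (c : ℕ → Pos) (sp : ℕ → Bool),
      c (n + 1) = c 0 ∧
      (∀ i ≤ n, if sp i then SpecialEdge S (c i) (c (i + 1))
                else NormalEdge S (c i) (c (i + 1))) ∧
      (∃ i ≤ n, sp i = true) ∧
      (∃ i ≤ n, ∃ a ∈ D, Reach S a.sig (c i).1)

noncomputable def dSL (S : Set TGD) : ℕ := (sch S).ncard * arity S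
noncomputable def fSL (S : Set TGD) : ℕ := (dSL S + 1) * tgdNorm S ^ (2 * arity S * (dSL S + 1))
noncomputable def dL (S : Set TGD) : ℕ := (sch S).ncard * arity S ^ (arity S + 1)
noncomputable def fL (S : Set TGD) : ℕ := (dL S + 1) * tgdNorm S ^ (2 * arity S * (dL S + 1))
noncomputable def dG (S : Set TGD) : ℕ :=
  (sch S).ncard * arity S ^ (2 * arity S + 1) * 2 ^ ((sch S).ncard * arity S ^ arity S)
noncomputable def fG (S : Set TGD) : ℕ := (dG S + 1) * tgdNorm S ^ (2 * arity S * (dG S + 1))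

/-! ### Simplification -/

open Classical in
/-- `unique(t̄)`: keep only the first occurrence of each term. -/
noncomputable def uniqueList {α : Type} : List α → List α
  | [] => []
  | a :: l => a :: uniqueList (l.filter fun b => decide (b ≠ a))
termination_by l => l.length
decreasing_by
  simp only [List.length_cons, List.length_unattach]
  exact Nat.lt_succ_of_le ((List.length_filter_le _ _).trans (le_of_eq List.length_attach))

open Classical in
/-- `id(t̄)`: for each component, the position of `unique(t̄)` at which it appears. -/
noncomputable def idTuple {α : Type} (l : List α) : List ℕ :=
  l.map (fun t => (uniqueList l).idxOf t)

/-- The simplification of an atom `R(t̄)`: the atom `R_{id(t̄)}(unique(t̄))`, where the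
fresh predicate name `R_{id(t̄)}` is obtained by pairing `R` with an encoding of `id(t̄)`. -/
noncomputable def simpleAtom {α : Type} (a : Atom α) : Atom α :=
  ⟨Nat.pair a.pred (Encodable.encode (idTuple a.args)), uniqueList a.args⟩

/-- `simple(D)`. -/
noncomputable def simpleDB (D : Database) : Database := D.image simpleAtom

/-- A specialization of the tuple of variables `xs`:
`f x₁ = x₁`, `f xᵢ ∈ {f x₁, …, f xᵢ₋₁, xᵢ}`, and `f` is the identity off `xs`. -/
def IsSpecialization (xs : List ℕ) (f : ℕ → ℕ) : Prop :=
  (∀ v, v ∉ xs → f v = v) ∧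
  ∀ i : Fin xs.length, f (xs.get i) ∈ ((xs.take i).map f) ++ [xs.get i]

/-- The body atom of a (linear) TGD. -/
def TGD.bodyAtom (σ : TGD) : Atom ℕ := σ.body.head σ.body_ne

/-- The simplification of a linear TGD induced by a specialization `f`. -/
noncomputable def TGD.simplify (σ : TGD) (f : ℕ → ℕ) : TGD where
  body := [simpleAtom (σ.bodyAtom.map f)]
  head := σ.head.map (fun b => simpleAtom (b.map f))
  body_ne := by simp
  head_ne := by
    intro hcon
    exact σ.head_ne (List.map_eq_nil_iff.mp hcon)

/-- `simple(Σ)`: all simplifications of TGDs of `Σ` induced by some specialization. -/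
def simpleTGDs (S : Set TGD) : Set TGD :=
  {τ | ∃ σ ∈ S, ∃ f : ℕ → ℕ, IsSpecialization σ.bodyAtom.args f ∧ τ = σ.simplify f}

/-- Equivalence of terms up to simplification: the map
`g = {f x ↦ h x : x ∈ fr(σ)}` is a well-defined function on `fr(σ_f)` (witnessed by the
section `sec` of `f`), and `g y ≡_sim h' y` for every `y ∈ fr(σ_f)`. -/
inductive EqSim : TermT → TermT → Prop
  | const (c : ℕ) : EqSim (.const c) (.const c)
  | null (σ : TGD) (f : ℕ → ℕ) (sec : ℕ → ℕ) (h h' : ℕ → TermT) (z : ℕ)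
      (hf : IsSpecialization σ.bodyAtom.args f)
      (hfun : ∀ x ∈ σ.frontier, ∀ y ∈ σ.frontier, f x = f y → h x = h y)
      (hdom : ∀ x ∈ σ.frontier, f x ∈ (σ.simplify f).frontier)
      (hsec : ∀ y ∈ (σ.simplify f).frontier, sec y ∈ σ.frontier ∧ f (sec y) = y)
      (hrec : ∀ y ∈ (σ.simplify f).frontier, EqSim (h (sec y)) (h' y)) :
      EqSim (.null σ h z) (.null (σ.simplify f) h' z)

/-- `t̄ ≃ ū`: same length and the same equalities among components. -/
def tupleEquiv {A B : Type} (t : List A) (u : List B) : Prop :=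
  t.length = u.length ∧ ∀ i j, i < t.length → j < t.length → (t[i]? = t[j]? ↔ u[i]? = u[j]?)

/-- Equivalence of atoms up to simplification. -/
noncomputable def AtomEqSim (α β : Atom TermT) : Prop :=
  β.pred = Nat.pair α.pred (Encodable.encode (idTuple α.args)) ∧
  tupleEquiv (uniqueList α.args) β.args ∧
  List.Forall₂ EqSim (uniqueList α.args) β.args

/-! ### Linearization -/

/-- The symbolic representation of a type: a canonical guard atom over positive integers
together with a finite set of further atoms over its terms. -/
abbrev SigmaType := Atom ℕ × Finset (Atom ℕ)

/-- A canonical tuple of positive integers: `t₁ = 1` and `tᵢ ≤ max(t₁,…,tᵢ₋₁) + 1`. -/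
def IsCanonicalTuple (l : List ℕ) : Prop :=
  ∀ (i : ℕ) (h : i < l.length), 1 ≤ l[i] ∧ l[i] ≤ ((l.take i).foldr max 0) + 1

def atomsOfType (τ : SigmaType) : Finset (Atom ℕ) := insert τ.1 τ.2

def IsSigmaType (S : Set TGD) (τ : SigmaType) : Prop :=
  IsCanonicalTuple τ.1.args ∧ τ.1.sig ∈ sch S ∧
  (∀ b ∈ τ.2, b.sig ∈ sch S ∧ ∀ t ∈ b.args, t ∈ τ.1.args) ∧ τ.1 ∉ τ.2

open Classical in
noncomputable def setToFinset {α : Type} (s : Set α) : Finset α :=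
  if h : s.Finite then h.toFinset else ∅

open Classical in
/-- Canonical renaming: the `i`-th distinct value of `base` (by first occurrence)
is sent to the integer `i` (1-based). -/
noncomputable def canonInt {α : Type} (base : List α) (c : α) : ℕ :=
  (uniqueList base).idxOf c + 1

/-- The type (over the constants of `a`) of the database atom `a` w.r.t. `D` and `S`. -/
def typeOfDBAtom (D : Database) (S : Set TGD) (a : Atom ℕ) : Set (Atom ℕ) :=
  {b | (b.map TermT.const) ∈ chase D S ∧ ∀ c ∈ b.args, c ∈ a.args}

/-- The linearization of a database atom: `[τ](t̄)` where `τ` encodes the atom and its type. -/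
noncomputable def linAtom (D : Database) (S : Set TGD) (a : Atom ℕ) : Atom ℕ :=
  let ρ : ℕ → ℕ := canonInt a.args
  let g : Atom ℕ := a.map ρ
  let τ : SigmaType := (g, (setToFinset ((Atom.map ρ) '' typeOfDBAtom D S a)).erase g)
  ⟨Encodable.encode τ, a.args⟩

/-- `lin(D)`. -/
noncomputable def linDB (D : Database) (S : Set TGD) : Database := D.image (linAtom D S)

/-- `complete(I,Σ)`: the atoms of the chase of `I` whose terms all belong to `adom(I)`. -/
def completeDB (I : Database) (S : Set TGD) : Set (Atom ℕ) :=
  {a | (a.map TermT.const) ∈ chase I S ∧ ∀ c ∈ a.args, ∃ b ∈ I, c ∈ b.args}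

/-- The index (1-based) of an existential variable of a TGD. -/
noncomputable def TGD.exIndex (σ : TGD) (v : ℕ) : ℕ := (σ.exVars.sort (· ≤ ·)).idxOf v + 1

/-- The function `f` of the linearization: frontier variables are mapped by `h`, the `i`-th
existential variable to `ar(Σ) + i`. -/
noncomputable def headMap (S : Set TGD) (σ : TGD) (h : ℕ → ℕ) : ℕ → ℕ :=
  fun v => if v ∈ σ.frontier then h v else arity S + σ.exIndex v

/-- The Σ-type associated with the head atom `b` of `σ` in the linearization step. -/
noncomputable def headTypeOf (S : Set TGD) (σ : TGD) (τ : SigmaType) (h : ℕ → ℕ)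
    (b : Atom ℕ) : SigmaType :=
  let f := headMap S σ h
  let αi : Atom ℕ := b.map f
  let I : Database := (σ.head.map (Atom.map f)).toFinset ∪ atomsOfType τ
  let Ti : Set (Atom ℕ) := {β | β ∈ completeDB I S ∧ ∀ t ∈ β.args, t ∈ αi.args} \ {αi}
  let ρ : ℕ → ℕ := canonInt αi.args
  (αi.map ρ, setToFinset ((Atom.map ρ) '' Ti))

/-- The linearization of the guarded TGD `σ` induced by the Σ-type `τ` and the
homomorphism `h` from `body(σ)` to `atoms(τ)` mapping the guard to `guard(τ)`. -/
noncomputable def linTGD (S : Set TGD) (σ : TGD) (τ : SigmaType) (h : ℕ → ℕ) : TGD where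
  body := [⟨Encodable.encode τ, σ.guard.args⟩]
  head := σ.head.map (fun b => ⟨Encodable.encode (headTypeOf S σ τ h b), b.args⟩)
  body_ne := by simp
  head_ne := by
    intro hcon
    exact σ.head_ne (List.map_eq_nil_iff.mp hcon)

def IsTypeHom (S : Set TGD) (σ : TGD) (τ : SigmaType) (h : ℕ → ℕ) : Prop :=
  (∀ b ∈ σ.body, b.map h ∈ atomsOfType τ) ∧ σ.guard.map h = τ.1

/-- `lin(Σ)`. -/
def linTGDs (S : Set TGD) : Set TGD :=
  {ρ | ∃ σ ∈ S, ∃ τ : SigmaType, IsSigmaType S τ ∧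
    ∃ h : ℕ → ℕ, IsTypeHom S σ τ h ∧ ρ = linTGD S σ τ h}

/-- Equivalence of terms up to linearization. -/
inductive EqLin (S : Set TGD) : TermT → TermT → Prop
  | const (c : ℕ) : EqLin S (.const c) (.const c)
  | null (σ : TGD) (τ : SigmaType) (g : ℕ → ℕ) (h h' : ℕ → TermT) (z : ℕ)
      (hτ : IsSigmaType S τ) (hg : IsTypeHom S σ τ g)
      (hfr : ∀ y ∈ (linTGD S σ τ g).frontier, EqLin S (h y) (h' y)) :
      EqLin S (.null σ h z) (.null (linTGD S σ τ g) h' z)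

/-- The type of an atom of the chase: all chase atoms whose terms occur in it. -/
def typeOf (D : Database) (S : Set TGD) (α : Atom TermT) : Set (Atom TermT) :=
  {β ∈ chase D S | ∀ t ∈ β.args, t ∈ α.args}

/-- Equivalence of atoms up to linearization. -/
def AtomEqLin (D : Database) (S : Set TGD) (α β : Atom TermT) : Prop :=
  ∃ τ : SigmaType, β.pred = Encodable.encode τ ∧ IsSigmaType S τ ∧
    (∃ μ : TermT → ℕ,
      Set.BijOn μ (adom (typeOf D S α)) {k | ∃ a ∈ atomsOfType τ, k ∈ a.args} ∧
      (Atom.map μ) '' typeOf D S α = ↑(atomsOfType τ) ∧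
      α.map μ = τ.1) ∧
    tupleEquiv α.args β.args ∧ List.Forall₂ (EqLin S) α.args β.args

noncomputable def gsimpleDB (D : Database) (S : Set TGD) : Database := simpleDB (linDB D S)
def gsimpleTGDs (S : Set TGD) : Set TGD := simpleTGDs (linTGDs S)



section UL
open Classical

theorem ul_nil {α : Type} : uniqueList ([] : List α) = [] := by
  rw [uniqueList]

theorem ul_cons {α : Type} (a : α) (l : List α) :
    uniqueList (a :: l) = a :: uniqueList (l.filter fun b => decide (b ≠ a)) := by
  rw [uniqueList]

theorem ul_mem_aux {α : Type} (n : ℕ) : ∀ (l : List α), l.length ≤ n → ∀ x,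
    x ∈ uniqueList l ↔ x ∈ l := by
  induction n with
  | zero =>
    intro l hl x
    have : l = [] := List.length_eq_zero_iff.mp (by omega)
    subst this
    simp [ul_nil]
  | succ n ih =>
    intro l hl x
    cases l with
    | nil => simp [ul_nil]
    | cons a l =>
      rw [ul_cons, List.mem_cons, ih _ ((List.length_filter_le _ _).trans (by simpa using hl))]
      simp only [List.mem_filter, List.mem_cons, decide_eq_true_eq]
      tauto

theorem ul_mem {α : Type} (l : List α) (x : α) : x ∈ uniqueList l ↔ x ∈ l :=
  ul_mem_aux l.length l le_rfl x

theorem ul_nodup_aux {α : Type} (n : ℕ) : ∀ (l : List α), l.length ≤ n →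
    (uniqueList l).Nodup := by
  induction n with
  | zero =>
    intro l hl
    have : l = [] := List.length_eq_zero_iff.mp (by omega)
    subst this
    simp [ul_nil]
  | succ n ih =>
    intro l hl
    cases l with
    | nil => simp [ul_nil]
    | cons a l =>
      rw [ul_cons, List.nodup_cons]
      refine ⟨?_, ih _ ((List.length_filter_le _ _).trans (by simpa using hl))⟩
      rw [ul_mem]
      simp

theorem ul_nodup {α : Type} (l : List α) : (uniqueList l).Nodup :=
  ul_nodup_aux l.length l le_rfl

theorem ul_map_aux {α β : Type} (g : α → β) (n : ℕ) : ∀ (l : List α), l.length ≤ n →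
    (∀ x ∈ l, ∀ y ∈ l, g x = g y → x = y) →
    uniqueList (l.map g) = (uniqueList l).map g := by
  induction n with
  | zero =>
    intro l hl _
    have : l = [] := List.length_eq_zero_iff.mp (by omega)
    subst this
    simp [ul_nil]
  | succ n ih =>
    intro l hl hg
    cases l with
    | nil => simp [ul_nil]
    | cons a l =>
      rw [List.map_cons, ul_cons, ul_cons, List.map_cons]
      congr 1
      rw [← ih _ ((List.length_filter_le _ _).trans (by simpa using hl))]
      · congr 1
        rw [List.filter_map]
        congr 1
        apply List.filter_congr
        intro x hx
        simp only [Function.comp, decide_eq_decide]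
        constructor
        · intro h h'
          exact h (by rw [h'])
        · intro h h'
          exact h (hg x (by simp [hx]) a (by simp) h')
      · intro x hx y hy
        exact hg x (by simp [(List.mem_filter.mp hx).1]) y (by simp [(List.mem_filter.mp hy).1])

theorem ul_map {α β : Type} (g : α → β) (l : List α)
    (hg : ∀ x ∈ l, ∀ y ∈ l, g x = g y → x = y) :
    uniqueList (l.map g) = (uniqueList l).map g :=
  ul_map_aux g l.length l le_rfl hg

theorem idxOf_map_inj {α β : Type} (g : α → β) (t : α) : ∀ (l : List α),
    (∀ x ∈ l, g x = g t → x = t) → (l.map g).idxOf (g t) = l.idxOf t := by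
  intro l
  induction l with
  | nil => intro _; simp
  | cons a l ih =>
    intro h
    rw [List.map_cons, List.idxOf_cons, List.idxOf_cons, ih (fun x hx => h x (by simp [hx]))]
    by_cases hat : a = t
    · simp [hat]
    · have : g a ≠ g t := fun h' => hat (h a (by simp) h')
      simp [hat, this, beq_eq_false_iff_ne.mpr]

theorem idTuple_map {α β : Type} (g : α → β) (l : List α)
    (hg : ∀ x ∈ l, ∀ y ∈ l, g x = g y → x = y) :
    idTuple (l.map g) = idTuple l := by
  unfold idTuple
  rw [List.map_map, ul_map g l hg]
  apply List.map_congr_left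
  intro t ht
  exact idxOf_map_inj g t _ (fun x hx h => hg x ((ul_mem _ _).mp hx) t ht h)

theorem recover_some {α : Type} (l : List α) :
    (idTuple l).map (fun i => (uniqueList l)[i]?) = l.map some := by
  unfold idTuple
  rw [List.map_map]
  apply List.map_congr_left
  intro t ht
  have h : (uniqueList l).idxOf t < (uniqueList l).length :=
    List.idxOf_lt_length_iff.mpr ((ul_mem _ _).mpr ht)
  simp [List.getElem?_eq_getElem h]

theorem recover {α β : Type} (h : α → β) (l : List α) (l' : List β)
    (h1 : idTuple l = idTuple l') (h2 : (uniqueList l).map h = uniqueList l') :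
    l' = l.map h := by
  have e := recover_some l'
  rw [← h1, ← h2] at e
  have e2 : (idTuple l).map (fun i => ((uniqueList l).map h)[i]?) = (l.map some).map (Option.map h) := by
    rw [← recover_some l, List.map_map]
    apply List.map_congr_left
    intro i _
    simp
  rw [e2] at e
  have : (l.map h).map some = l'.map some := by
    rw [← e]; simp
  exact ((List.map_injective_iff.mpr (Option.some_injective _)) this).symm

end UL

theorem simpleAtom_map {α β : Type} (g : α → β) (a : Atom α)
    (hg : ∀ x ∈ a.args, ∀ y ∈ a.args, g x = g y → x = y) :
    simpleAtom (a.map g) = (simpleAtom a).map g := by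
  simp [simpleAtom, Atom.map, ul_map g _ hg, idTuple_map g _ hg]

theorem simpleAtom_recover {α β : Type} (h : α → β) (a : Atom α) (a' : Atom β)
    (e : (simpleAtom a).map h = simpleAtom a') :
    a' = a.map h ∧ ∀ x ∈ a.args, ∀ y ∈ a.args, h x = h y → x = y := by
  simp only [simpleAtom, Atom.map, Atom.mk.injEq] at e
  obtain ⟨e1, e2⟩ := e
  rw [Nat.pair_eq_pair] at e1
  obtain ⟨e1, e3⟩ := e1
  have e3 := Encodable.encode_injective e3
  refine ⟨?_, ?_⟩
  · have := recover h a.args a'.args e3 e2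
    cases a'; cases a
    simp_all [Atom.map]
  · have hn : ((uniqueList a.args).map h).Nodup := by rw [e2]; exact ul_nodup _
    intro x hx y hy hxy
    exact List.inj_on_of_nodup_map hn ((ul_mem _ _).mpr hx) ((ul_mem _ _).mpr hy) hxy

theorem map_map_atom {A B C : Type} (f : A → B) (g : B → C) (a : Atom A) :
    (a.map f).map g = a.map (g ∘ f) := by
  simp [Atom.map]

theorem map_congr_atom {A B : Type} (f g : A → B) (a : Atom A) (h : ∀ x ∈ a.args, f x = g x) :
    a.map f = a.map g := by
  simp only [Atom.map, Atom.mk.injEq, true_and]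
  exact List.map_congr_left h

theorem mem_foldr_vars (l : List (Atom ℕ)) (x : ℕ) :
    x ∈ l.foldr (fun a s => atomVars a ∪ s) ∅ ↔ ∃ a ∈ l, x ∈ a.args := by
  induction l with
  | nil => simp
  | cons a l ih => rw [List.foldr_cons, Finset.mem_union, ih]; simp [atomVars]

theorem mem_bodyVars (σ : TGD) (x : ℕ) : x ∈ σ.bodyVars ↔ ∃ a ∈ σ.body, x ∈ a.args :=
  mem_foldr_vars _ _

theorem mem_headVars (σ : TGD) (x : ℕ) : x ∈ σ.headVars ↔ ∃ a ∈ σ.head, x ∈ a.args :=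
  mem_foldr_vars _ _

theorem spec_mem (xs : List ℕ) (f : ℕ → ℕ) (hf : IsSpecialization xs f) :
    ∀ x ∈ xs, f x ∈ xs := by
  have key : ∀ n, ∀ (h : n < xs.length), f (xs[n]) ∈ xs := by
    intro n
    induction n using Nat.strong_induction_on with
    | _ n ih =>
      intro h
      have := hf.2 ⟨n, h⟩
      simp only [List.get_eq_getElem, List.mem_append, List.mem_map, List.mem_singleton] at this
      rcases this with ⟨a, ha, e⟩ | e
      · rw [List.mem_take_iff_getElem] at ha
        obtain ⟨j, hj, rfl⟩ := ha
        rw [← e]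
        exact ih j (by omega) (by omega)
      · rw [e]; exact List.getElem_mem h
  intro x hx
  obtain ⟨n, h, rfl⟩ := List.getElem_of_mem hx
  exact key n h

open Classical in
theorem spec_exists {T : Type} (xs : List ℕ) (h : ℕ → T) : ∃ f, IsSpecialization xs f ∧
    (∀ x ∈ xs, h (f x) = h x) ∧ (∀ x ∈ xs, ∀ y ∈ xs, h x = h y → f x = f y) := by
  let f : ℕ → ℕ := fun x => if x ∈ xs then (xs.find? (fun y => decide (h y = h x))).getD x else x
  have hfind : ∀ x ∈ xs, ∃ y as bs, f x = y ∧ h y = h x ∧ xs = as ++ y :: bs ∧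
      ∀ a ∈ as, h a ≠ h x := by
    intro x hx
    have hs : (xs.find? (fun y => decide (h y = h x))).isSome := by
      rw [List.find?_isSome]; exact ⟨x, hx, by simp⟩
    obtain ⟨y, hy⟩ := Option.isSome_iff_exists.mp hs
    have hy' := hy
    rw [List.find?_eq_some_iff_append] at hy
    obtain ⟨h1, as, bs, h2, h3⟩ := hy
    refine ⟨y, as, bs, ?_, by simpa using h1, h2, ?_⟩
    · simp [f, hx, hy']
    · intro a ha; simpa using h3 a ha
  have hsame : ∀ x ∈ xs, ∀ y ∈ xs, h x = h y → f x = f y := by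
    intro x hx y hy hxy
    have hs : (xs.find? (fun z => decide (h z = h y))).isSome := by
      rw [List.find?_isSome]; exact ⟨y, hy, by simp⟩
    obtain ⟨z, hz⟩ := Option.isSome_iff_exists.mp hs
    simp [f, hx, hy, hxy, hz]
  refine ⟨f, ⟨fun v hv => by simp [f, hv], ?_⟩, ?_, hsame⟩
  · rintro ⟨i, hi⟩
    simp only [List.get_eq_getElem]
    obtain ⟨y, as, bs, e1, e2, e3, e4⟩ := hfind xs[i] (List.getElem_mem hi)
    have hk : as.length < xs.length := by rw [e3]; simp
    have hy : xs[as.length] = y := by simp [e3]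
    have hle : as.length ≤ i := by
      by_contra hlt
      push Not at hlt
      have : xs[i] ∈ as := by
        have : xs[i] = as[i] := by simp [e3, List.getElem_append_left hlt]
        rw [this]; exact List.getElem_mem _
      exact e4 _ this rfl
    have hym : y ∈ xs := by rw [e3]; simp
    rcases hle.eq_or_lt with heq | hlt
    · apply List.mem_append_right
      subst heq
      rw [List.mem_singleton, e1, hy]
    · apply List.mem_append_left
      rw [List.mem_map]
      refine ⟨y, ?_, hsame y hym _ (List.getElem_mem hi) e2⟩
      rw [List.mem_take_iff_getElem]
      exact ⟨as.length, by omega, hy⟩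
  · intro x hx
    obtain ⟨y, as, bs, e1, e2, _, _⟩ := hfind x hx
    rw [e1, e2]

theorem depth_null (σ : TGD) (h : ℕ → TermT) (z : ℕ) :
    (TermT.null σ (σ.restrict h) z).depth = 1 + σ.frontier.sup (fun x => (h x).depth) := by
  rw [TermT.depth]
  congr 1
  apply Finset.sup_congr rfl
  intro x hx
  simp [TGD.restrict, hx]

theorem mu_ne (σ : TGD) (h : ℕ → TermT) (x z : ℕ) (hx : x ∈ σ.frontier) :
    h x ≠ .null σ (σ.restrict h) z := by
  intro e
  have := congrArg TermT.depth e
  rw [depth_null] at this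
  have h2 := Finset.le_sup (f := fun x => (h x).depth) hx
  omega

section Key
variable (σ : TGD) (b : Atom ℕ) (hb : σ.body = [b]) (f : ℕ → ℕ)
  (hf : IsSpecialization σ.bodyAtom.args f)
include hb

theorem bodyAtom_eq : σ.bodyAtom = b := by
  simp [TGD.bodyAtom, hb]

include hf

theorem frontier_iff (x : ℕ) (hx : x ∈ σ.headVars) :
    f x ∈ (σ.simplify f).frontier ↔ x ∈ σ.frontier := by
  have hba := bodyAtom_eq σ b hb
  rw [hba] at hf
  have hm := spec_mem _ _ hf
  simp only [TGD.frontier, Finset.mem_inter, mem_bodyVars, mem_headVars, hb, TGD.simplify,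
    List.mem_singleton, exists_eq_left, hba]
  constructor
  · rintro ⟨h1, h2⟩
    refine ⟨?_, (mem_headVars _ _).mp hx⟩
    simp only [simpleAtom, ul_mem, Atom.map, List.mem_map] at h1
    obtain ⟨y, hy, e⟩ := h1
    by_contra hxb
    rw [hf.1 x hxb] at e
    exact hxb (e ▸ hm y hy)
  · rintro ⟨h1, c, hc, hxc⟩
    refine ⟨?_, simpleAtom (c.map f), List.mem_map.mpr ⟨c, hc, rfl⟩, ?_⟩
    · simp only [simpleAtom, ul_mem, Atom.map, List.mem_map]
      exact ⟨x, h1, rfl⟩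
    · simp only [simpleAtom, ul_mem, Atom.map, List.mem_map]
      exact ⟨x, hxc, rfl⟩

theorem frontier_eq : (σ.simplify f).frontier = σ.frontier.image f := by
  ext y
  rw [Finset.mem_image]
  constructor
  · intro hy
    have h2 := (Finset.mem_inter.mp hy).2
    rw [mem_headVars] at h2
    obtain ⟨a, ha, hya⟩ := h2
    obtain ⟨c, hc, rfl⟩ := List.mem_map.mp ha
    simp only [simpleAtom, ul_mem, Atom.map, List.mem_map] at hya
    obtain ⟨x, hx, rfl⟩ := hya
    exact ⟨x, (frontier_iff σ b hb f hf x ((mem_headVars _ _).mpr ⟨c, hc, hx⟩)).mp hy, rfl⟩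
  · rintro ⟨x, hx, rfl⟩
    exact (frontier_iff σ b hb f hf x (Finset.mem_inter.mp hx).2).mpr hx

theorem frontier_body (x : ℕ) (hx : x ∈ σ.frontier) : x ∈ b.args := by
  have := (Finset.mem_inter.mp hx).1
  rw [mem_bodyVars, hb] at this
  simpa using this

theorem ex_fix (x : ℕ) (hx : x ∈ σ.headVars) (hn : x ∉ σ.frontier) : f x = x := by
  apply hf.1
  rw [bodyAtom_eq σ b hb]
  intro h
  exact hn (Finset.mem_inter.mpr ⟨(mem_bodyVars _ _).mpr (by simpa [hb] using h), hx⟩)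

variable (h h' : ℕ → TermT)
  (hA : ∀ x ∈ b.args, ∀ y ∈ b.args, h x = h y ↔ f x = f y)
  (hB : ∀ x ∈ b.args, ∀ y ∈ b.args, h' (f x) = h' (f y) → f x = f y)
  (hC : ∀ x ∈ b.args, (h x).depth = (h' (f x)).depth)

include hC in
theorem key_depth (x : ℕ) (hx : x ∈ σ.headVars) :
    (σ.mu h x).depth = ((σ.simplify f).mu h' (f x)).depth := by
  have hi := frontier_iff σ b hb f hf x hx
  unfold TGD.mu
  by_cases hxf : x ∈ σ.frontier
  · rw [if_pos hxf, if_pos (hi.mpr hxf)]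
    exact hC x (frontier_body σ b hb f hf x hxf)
  · rw [if_neg hxf, if_neg (fun hh => hxf (hi.mp hh)), depth_null, depth_null,
      frontier_eq σ b hb f hf, Finset.sup_image]
    congr 1
    apply Finset.sup_congr rfl
    intro y hy
    exact hC y (frontier_body σ b hb f hf y hy)

include hA in
theorem key_left (x : ℕ) (hx : x ∈ σ.headVars) (y : ℕ) (hy : y ∈ σ.headVars) :
    σ.mu h x = σ.mu h y ↔ f x = f y := by
  have hix := frontier_iff σ b hb f hf x hx
  have hiy := frontier_iff σ b hb f hf y hy
  unfold TGD.mu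
  by_cases hxf : x ∈ σ.frontier <;> by_cases hyf : y ∈ σ.frontier
  · rw [if_pos hxf, if_pos hyf]
    exact hA _ (frontier_body σ b hb f hf x hxf) _ (frontier_body σ b hb f hf y hyf)
  · rw [if_pos hxf, if_neg hyf]
    refine iff_of_false (mu_ne σ h x y hxf) (fun e => ?_)
    exact hyf (hiy.mp (e ▸ hix.mpr hxf))
  · rw [if_neg hxf, if_pos hyf]
    refine iff_of_false (mu_ne σ h y x hyf).symm (fun e => ?_)
    exact hxf (hix.mp (e ▸ hiy.mpr hyf))
  · rw [if_neg hxf, if_neg hyf, ex_fix σ b hb f hf x hx hxf, ex_fix σ b hb f hf y hy hyf]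
    simp

include hB in
theorem key_right (x : ℕ) (hx : x ∈ σ.headVars) (y : ℕ) (hy : y ∈ σ.headVars) :
    (σ.simplify f).mu h' (f x) = (σ.simplify f).mu h' (f y) → f x = f y := by
  have hix := frontier_iff σ b hb f hf x hx
  have hiy := frontier_iff σ b hb f hf y hy
  unfold TGD.mu
  by_cases hxf : x ∈ σ.frontier <;> by_cases hyf : y ∈ σ.frontier
  · rw [if_pos (hix.mpr hxf), if_pos (hiy.mpr hyf)]
    exact hB _ (frontier_body σ b hb f hf x hxf) _ (frontier_body σ b hb f hf y hyf)
  · rw [if_pos (hix.mpr hxf), if_neg (fun hh => hyf (hiy.mp hh))]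
    exact fun e => absurd e (mu_ne _ h' _ _ (hix.mpr hxf))
  · rw [if_neg (fun hh => hxf (hix.mp hh)), if_pos (hiy.mpr hyf)]
    exact fun e => absurd e.symm (mu_ne _ h' _ _ (hiy.mpr hyf))
  · rw [if_neg (fun hh => hxf (hix.mp hh)), if_neg (fun hh => hyf (hiy.mp hh))]
    simp

end Key

/-- `α` and `α'` have the same predicate, equality pattern, and depths. -/
def RelA (α α' : Atom TermT) : Prop :=
  ∃ φ : TermT → TermT, α' = α.map φ ∧
    (∀ x ∈ α.args, ∀ y ∈ α.args, φ x = φ y → x = y) ∧ ∀ x ∈ α.args, (φ x).depth = x.depth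

open Classical in
theorem RelA.of_template (c : Atom ℕ) (g g' : ℕ → TermT)
    (h1 : ∀ x ∈ c.args, ∀ y ∈ c.args, g x = g y ↔ g' x = g' y)
    (h2 : ∀ x ∈ c.args, (g x).depth = (g' x).depth) : RelA (c.map g) (c.map g') := by
  let φ : TermT → TermT := fun t => if ht : ∃ x ∈ c.args, g x = t then g' ht.choose else t
  have hφ : ∀ x ∈ c.args, φ (g x) = g' x := by
    intro x hx
    have ht : ∃ y ∈ c.args, g y = g x := ⟨x, hx, rfl⟩
    simp only [φ]
    rw [dif_pos ht]
    exact (h1 _ ht.choose_spec.1 _ hx).mp ht.choose_spec.2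
  refine ⟨φ, ?_, ?_, ?_⟩
  · rw [map_map_atom]
    exact map_congr_atom _ _ _ (fun x hx => (hφ x hx).symm)
  · intro s hs t ht
    obtain ⟨x, hx, rfl⟩ := List.mem_map.mp hs
    obtain ⟨y, hy, rfl⟩ := List.mem_map.mp ht
    rw [hφ x hx, hφ y hy, h1 x hx y hy]
    exact id
  · intro s hs
    obtain ⟨x, hx, rfl⟩ := List.mem_map.mp hs
    rw [hφ x hx, h2 x hx]

open Classical in
theorem RelA.symm {α α' : Atom TermT} (h : RelA α α') : RelA α' α := by
  obtain ⟨φ, rfl, h1, h2⟩ := h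
  let ψ : TermT → TermT := fun t => if ht : ∃ x ∈ α.args, φ x = t then ht.choose else t
  have hψ : ∀ x ∈ α.args, ψ (φ x) = x := by
    intro x hx
    have ht : ∃ y ∈ α.args, φ y = φ x := ⟨x, hx, rfl⟩
    simp only [ψ]
    rw [dif_pos ht]
    exact h1 _ ht.choose_spec.1 _ hx ht.choose_spec.2
  refine ⟨ψ, ?_, ?_, ?_⟩
  · rw [map_map_atom]
    have := map_congr_atom (ψ ∘ φ) id α (fun x hx => hψ x hx)
    rw [this]
    simp [Atom.map]
  · intro s hs t ht
    obtain ⟨x, hx, rfl⟩ := List.mem_map.mp hs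
    obtain ⟨y, hy, rfl⟩ := List.mem_map.mp ht
    rw [hψ x hx, hψ y hy]
    rintro rfl; rfl
  · intro s hs
    obtain ⟨x, hx, rfl⟩ := List.mem_map.mp hs
    rw [hψ x hx, h2 x hx]

theorem RelA.depths {α α' : Atom TermT} (h : RelA α α') :
    ∀ t ∈ α.args, ∃ t' ∈ (simpleAtom α').args, t'.depth = t.depth := by
  obtain ⟨φ, rfl, h1, h2⟩ := h
  intro t ht
  exact ⟨φ t, (ul_mem _ _).mpr (List.mem_map.mpr ⟨t, ht, rfl⟩), h2 t ht⟩

theorem RelA.depths' {α α' : Atom TermT} (h : RelA α α') :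
    ∀ t' ∈ (simpleAtom α').args, ∃ t ∈ α.args, t.depth = t'.depth := by
  obtain ⟨φ, rfl, h1, h2⟩ := h
  intro t' ht0
  obtain ⟨t, ht, rfl⟩ := List.mem_map.mp ((ul_mem _ _).mp ht0)
  exact ⟨t, ht, (h2 t ht).symm⟩

theorem step_common (σ : TGD) (b : Atom ℕ) (hb : σ.body = [b]) (f : ℕ → ℕ)
    (hf : IsSpecialization σ.bodyAtom.args f) (h h' : ℕ → TermT)
    (hA : ∀ x ∈ b.args, ∀ y ∈ b.args, h x = h y ↔ f x = f y)
    (hB : ∀ x ∈ b.args, ∀ y ∈ b.args, h' (f x) = h' (f y) → f x = f y)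
    (hC : ∀ x ∈ b.args, (h x).depth = (h' (f x)).depth) (c : Atom ℕ) (hc : c ∈ σ.head) :
    RelA (c.map (σ.mu h)) (c.map ((σ.simplify f).mu h' ∘ f)) ∧
    (simpleAtom (c.map f)).map ((σ.simplify f).mu h') =
      simpleAtom (c.map ((σ.simplify f).mu h' ∘ f)) := by
  have hv : ∀ x ∈ c.args, x ∈ σ.headVars := fun x hx => (mem_headVars _ _).mpr ⟨c, hc, hx⟩
  constructor
  · apply RelA.of_template
    · intro x hx y hy
      rw [key_left σ b hb f hf h hA x (hv x hx) y (hv y hy)]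
      exact ⟨fun e => by simp [e],
        key_right σ b hb f hf h' hB x (hv x hx) y (hv y hy)⟩
    · intro x hx
      exact key_depth σ b hb f hf h h' hC x (hv x hx)
  · rw [← map_map_atom]
    refine (simpleAtom_map _ (c.map f) ?_).symm
    intro s hs t ht
    obtain ⟨x, hx, rfl⟩ := List.mem_map.mp hs
    obtain ⟨y, hy, rfl⟩ := List.mem_map.mp ht
    exact key_right σ b hb f hf h' hB x (hv x hx) y (hv y hy)

theorem const_inj_args (a : Atom ℕ) :
    simpleAtom (a.map TermT.const) = (simpleAtom a).map TermT.const :=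
  simpleAtom_map _ _ (fun x _ y _ e => by injection e)

theorem RelA.rfl' (α : Atom TermT) : RelA α α :=
  ⟨id, by simp [Atom.map], fun _ _ _ _ e => e, fun _ _ => rfl⟩

theorem chase_forward (D : Database) (S : Set TGD) (hlin : ∀ σ ∈ S, σ.Linear) (α : Atom TermT)
    (hα : InChase D S α) :
    ∃ α', RelA α α' ∧ InChase (simpleDB D) (simpleTGDs S) (simpleAtom α') := by
  induction hα with
  | @db a ha =>
    refine ⟨a.map TermT.const, RelA.rfl' _, ?_⟩
    rw [const_inj_args]
    exact InChase.db (Finset.mem_image_of_mem _ ha)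
  | @step σ hσ h hbd a ha ih =>
    obtain ⟨b, hb⟩ := hlin σ hσ
    obtain ⟨α', ⟨φ, rfl, h1, h2⟩, hin⟩ := ih b (by simp [hb])
    obtain ⟨c, hc, rfl⟩ := ha
    obtain ⟨f, hf, hf1, hf2⟩ := spec_exists b.args h
    have hm : ∀ x ∈ b.args, h x ∈ (b.map h).args := fun x hx => List.mem_map_of_mem hx
    have hA : ∀ x ∈ b.args, ∀ y ∈ b.args, h x = h y ↔ f x = f y := by
      intro x hx y hy
      refine ⟨hf2 x hx y hy, fun e => ?_⟩
      rw [← hf1 x hx, ← hf1 y hy, e]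
    have hB : ∀ x ∈ b.args, ∀ y ∈ b.args, (φ ∘ h) (f x) = (φ ∘ h) (f y) → f x = f y := by
      intro x hx y hy e
      simp only [Function.comp, hf1 x hx, hf1 y hy] at e
      exact hf2 x hx y hy (h1 _ (hm x hx) _ (hm y hy) e)
    have hC : ∀ x ∈ b.args, (h x).depth = ((φ ∘ h) (f x)).depth := by
      intro x hx
      simp only [Function.comp, hf1 x hx]
      exact (h2 _ (hm x hx)).symm
    have hba := bodyAtom_eq σ b hb
    have hfs : IsSpecialization σ.bodyAtom.args f := by rw [hba]; exact hf
    obtain ⟨r1, r2⟩ := step_common σ b hb f hfs h (φ ∘ h) hA hB hC c hc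
    refine ⟨_, r1, ?_⟩
    have hmem : σ.simplify f ∈ simpleTGDs S := ⟨σ, hσ, f, hfs, rfl⟩
    refine InChase.step hmem (φ ∘ h) ?_
      ⟨simpleAtom (c.map f), List.mem_map.mpr ⟨c, hc, rfl⟩, r2.symm⟩
    intro b' hb'
    simp only [TGD.simplify, List.mem_singleton] at hb'
    subst hb'
    rw [hba, ← simpleAtom_map]
    · have : (b.map f).map (φ ∘ h) = (b.map h).map φ := by
        rw [map_map_atom, map_map_atom]
        apply map_congr_atom
        intro x hx
        simp [hf1 x hx]
      rw [this]; exact hin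
    · intro s hs t ht
      obtain ⟨x, hx, rfl⟩ := List.mem_map.mp hs
      obtain ⟨y, hy, rfl⟩ := List.mem_map.mp ht
      exact hB x hx y hy

theorem chase_backward (D : Database) (S : Set TGD) (hlin : ∀ σ ∈ S, σ.Linear) (β : Atom TermT)
    (hβ : InChase (simpleDB D) (simpleTGDs S) β) :
    ∃ α α', RelA α α' ∧ β = simpleAtom α' ∧ InChase D S α := by
  induction hβ with
  | @db a' ha' =>
    obtain ⟨a, ha, rfl⟩ := Finset.mem_image.mp ha'
    exact ⟨a.map TermT.const, a.map TermT.const, RelA.rfl' _, (const_inj_args a).symm,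
      InChase.db ha⟩
  | @step τ hτ h' hbd a ha ih =>
    obtain ⟨σ, hσ, f, hf, rfl⟩ := hτ
    obtain ⟨b, hb⟩ := hlin σ hσ
    have hba := bodyAtom_eq σ b hb
    obtain ⟨c', hc', rfl⟩ := ha
    obtain ⟨c, hc, rfl⟩ := List.mem_map.mp hc'
    obtain ⟨α, α', hr, e, hin⟩ := ih (simpleAtom (b.map f)) (by simp [TGD.simplify, hba])
    obtain ⟨rfl, hinj⟩ := simpleAtom_recover _ _ _ e
    obtain ⟨ψ, rfl, h1, h2⟩ := hr.symm
    have hmf : ∀ x ∈ b.args, f x ∈ (b.map f).args := fun x hx => List.mem_map_of_mem hx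
    have hm : ∀ x ∈ b.args, h' (f x) ∈ ((b.map f).map h').args :=
      fun x hx => List.mem_map_of_mem (hmf x hx)
    have hB : ∀ x ∈ b.args, ∀ y ∈ b.args, h' (f x) = h' (f y) → f x = f y :=
      fun x hx y hy => hinj _ (hmf x hx) _ (hmf y hy)
    have hA : ∀ x ∈ b.args, ∀ y ∈ b.args, (ψ ∘ h' ∘ f) x = (ψ ∘ h' ∘ f) y ↔ f x = f y := by
      intro x hx y hy
      refine ⟨fun e => hB x hx y hy (h1 _ (hm x hx) _ (hm y hy) e), fun e => by simp [e]⟩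
    have hC : ∀ x ∈ b.args, ((ψ ∘ h' ∘ f) x).depth = (h' (f x)).depth :=
      fun x hx => h2 _ (hm x hx)
    obtain ⟨r1, r2⟩ := step_common σ b hb f hf (ψ ∘ h' ∘ f) h' hA hB hC c hc
    refine ⟨_, _, r1, r2, ?_⟩
    refine InChase.step hσ (ψ ∘ h' ∘ f) ?_ ⟨c, hc, rfl⟩
    intro b' hb'
    rw [hb, List.mem_singleton] at hb'
    subst hb'
    rw [map_map_atom, map_map_atom] at hin
    exact hin

/-! ### Finiteness versus bounded depth -/

theorem spec_finite (xs : List ℕ) : {f | IsSpecialization xs f}.Finite := by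
  have : {f | IsSpecialization xs f} ⊆ Set.range
      (fun (g : {x // x ∈ xs} → {x // x ∈ xs}) => fun x => if h : x ∈ xs then (g ⟨x, h⟩ : ℕ) else x) := by
    intro f hf
    refine ⟨fun x => ⟨f x, spec_mem xs f hf x x.2⟩, ?_⟩
    funext x
    by_cases hx : x ∈ xs
    · simp [hx]
    · simp [hx, hf.1 x hx]
  exact (Set.finite_range _).subset this

theorem simpleTGDs_finite (S : Set TGD) (hS : S.Finite) : (simpleTGDs S).Finite := by
  have : simpleTGDs S = ⋃ σ ∈ S, (fun f => σ.simplify f) '' {f | IsSpecialization σ.bodyAtom.args f} := by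
    ext τ
    simp only [simpleTGDs, Set.mem_ofPred_eq, Set.mem_iUnion, Set.mem_image, exists_prop]
    constructor
    · rintro ⟨σ, h, f, hf, rfl⟩; exact ⟨σ, h, f, hf, rfl⟩
    · rintro ⟨σ, h, f, hf, rfl⟩; exact ⟨σ, h, f, hf, rfl⟩
  rw [this]
  exact hS.biUnion (fun σ _ => (spec_finite _).image _)

theorem term_form (D : Database) (S : Set TGD) (a : Atom TermT) (ha : InChase D S a) :
    ∀ t ∈ a.args, (∃ b ∈ D, ∃ c ∈ b.args, t = .const c) ∨
      ∃ σ ∈ S, ∃ h, ∃ z ∈ σ.headVars, t = .null σ (σ.restrict h) z ∧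
        ∀ x ∈ σ.frontier, h x ∈ adom (chase D S) := by
  induction ha with
  | @db b hb =>
    intro t ht
    obtain ⟨c, hc, rfl⟩ := List.mem_map.mp ht
    exact Or.inl ⟨b, hb, c, hc, rfl⟩
  | @step σ hσ h hbd a ha ih =>
    intro t ht
    obtain ⟨c, hc, rfl⟩ := ha
    obtain ⟨x, hx, rfl⟩ := List.mem_map.mp ht
    have hfr : ∀ y ∈ σ.frontier, ∃ b ∈ σ.body, h y ∈ (b.map h).args := by
      intro y hy
      obtain ⟨b, hb, hyb⟩ := (mem_bodyVars _ _).mp (Finset.mem_inter.mp hy).1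
      exact ⟨b, hb, List.mem_map_of_mem hyb⟩
    unfold TGD.mu
    by_cases hxf : x ∈ σ.frontier
    · rw [if_pos hxf]
      obtain ⟨b, hb, hm⟩ := hfr x hxf
      exact ih b hb _ hm
    · rw [if_neg hxf]
      refine Or.inr ⟨σ, hσ, h, x, (mem_headVars _ _).mpr ⟨c, hc, hx⟩, rfl, ?_⟩
      intro y hy
      obtain ⟨b, hb, hm⟩ := hfr y hy
      exact ⟨_, hbd b hb, hm⟩

theorem restrict_finite (σ : TGD) (F : Set TermT) (hF : F.Finite) :
    {r | ∃ h : ℕ → TermT, (∀ x ∈ σ.frontier, h x ∈ F) ∧ r = σ.restrict h}.Finite := by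
  have := hF.to_subtype
  have hsub : {r | ∃ h : ℕ → TermT, (∀ x ∈ σ.frontier, h x ∈ F) ∧ r = σ.restrict h} ⊆
      Set.range (fun (g : {x // x ∈ σ.frontier} → F) =>
        fun x => if hx : x ∈ σ.frontier then (g ⟨x, hx⟩ : TermT) else .const 0) := by
    rintro r ⟨h, hh, rfl⟩
    refine ⟨fun x => ⟨h x, hh x x.2⟩, ?_⟩
    funext x
    by_cases hx : x ∈ σ.frontier <;> simp [TGD.restrict, hx]
  exact (Set.finite_range _).subset hsub

theorem terms_finite (D : Database) (S : Set TGD) (hS : S.Finite) (n : ℕ) :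
    {t | t ∈ adom (chase D S) ∧ t.depth < n}.Finite := by
  induction n with
  | zero => simp
  | succ n ih =>
    set F := {t | t ∈ adom (chase D S) ∧ t.depth < n} with hFdef
    have hfin : ((⋃ b ∈ D, TermT.const '' {c | c ∈ b.args}) ∪ ⋃ σ ∈ S, Set.image2 (TermT.null σ)
        {r | ∃ h : ℕ → TermT, (∀ x ∈ σ.frontier, h x ∈ F) ∧ r = σ.restrict h}
        (σ.headVars : Set ℕ)).Finite := by
      apply Set.Finite.union
      · exact D.finite_toSet.biUnion (fun b _ => (List.finite_toSet b.args).image _)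
      · exact hS.biUnion (fun σ _ => (restrict_finite σ F ih).image2 _ (Finset.finite_toSet _))
    refine hfin.subset ?_
    rintro t ⟨⟨a, ha, hta⟩, hd⟩
    rcases term_form D S a ha t hta with ⟨b, hb, c, hc, rfl⟩ | ⟨σ, hσ, h, z, hz, rfl, hh⟩
    · left
      simp only [Set.mem_iUnion]
      exact ⟨b, hb, c, hc, rfl⟩
    · right
      simp only [Set.mem_iUnion]
      refine ⟨σ, hσ, _, ⟨h, ?_, rfl⟩, z, hz, rfl⟩
      intro x hx
      refine ⟨hh x hx, ?_⟩
      rw [depth_null] at hd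
      have h2 := Finset.le_sup (f := fun x => (h x).depth) hx
      omega

theorem sig_finite (D : Database) (S : Set TGD) (hS : S.Finite) :
    (Atom.sig '' chase D S).Finite := by
  have hfin : ((⋃ b ∈ D, {b.sig}) ∪ ⋃ σ ∈ S, Atom.sig '' {c | c ∈ σ.head}).Finite := by
    apply Set.Finite.union
    · exact D.finite_toSet.biUnion (fun b _ => Set.finite_singleton _)
    · exact hS.biUnion (fun σ _ => (List.finite_toSet σ.head).image _)
  refine hfin.subset ?_
  rintro _ ⟨a, ha, rfl⟩
  cases ha with
  | @db b hb =>
    left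
    simp only [Set.mem_iUnion]
    exact ⟨b, hb, by simp [Atom.sig, Atom.map]⟩
  | @step σ hσ h hbd _ ha =>
    right
    obtain ⟨c, hc, rfl⟩ := ha
    simp only [Set.mem_iUnion]
    exact ⟨σ, hσ, c, hc, by simp [Atom.sig, Atom.map]⟩

theorem finite_iff (D : Database) (S : Set TGD) (hS : S.Finite) :
    (chase D S).Finite ↔ ∃ n, ∀ t ∈ adom (chase D S), t.depth < n := by
  constructor
  · intro hc
    have : (adom (chase D S)).Finite := by
      have e : adom (chase D S) = ⋃ a ∈ chase D S, {t | t ∈ a.args} := by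
        ext t; simp [adom]
      rw [e]
      exact hc.biUnion (fun a _ => List.finite_toSet a.args)
    obtain ⟨n, hn⟩ := (this.image TermT.depth).bddAbove
    exact ⟨n + 1, fun t ht => Nat.lt_succ_of_le (hn ⟨t, ht, rfl⟩)⟩
  · rintro ⟨n, hn⟩
    have hF := terms_finite D S hS n
    set F := {t | t ∈ adom (chase D S) ∧ t.depth < n} with hFdef
    have := hF.to_subtype
    have hfin : (⋃ p ∈ Atom.sig '' chase D S, Set.range
        (fun v : Fin p.2 → F => (⟨p.1, List.ofFn (fun i => (v i : TermT))⟩ : Atom TermT))).Finite :=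
      (sig_finite D S hS).biUnion (fun p _ => Set.finite_range _)
    refine hfin.subset ?_
    intro a ha
    simp only [Set.mem_iUnion]
    refine ⟨a.sig, ⟨a, ha, rfl⟩, ?_⟩
    have hm : ∀ i : Fin a.args.length, a.args.get i ∈ F := by
      intro i
      have : a.args.get i ∈ adom (chase D S) := ⟨a, ha, List.get_mem _ _⟩
      exact ⟨this, hn _ this⟩
    refine ⟨fun i => ⟨a.args.get i, hm i⟩, ?_⟩
    cases a
    simp [Atom.sig]

/-- Simplification preserves chase termination and maximal term depth:
for `Σ ∈ L`, (1) `Σ ∈ CT_D ↔ simple(Σ) ∈ CT_{simple(D)}` and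
(2) `maxdepth(D,Σ) = maxdepth(simple(D),simple(Σ))`. -/
theorem simplification_preserves_chase (D : Database) (S : Set TGD) (hfin : S.Finite)
    (hlin : ∀ σ ∈ S, σ.Linear) :
    (InCT D S ↔ InCT (simpleDB D) (simpleTGDs S)) ∧
    maxdepth D S = maxdepth (simpleDB D) (simpleTGDs S) := by
  have F : ∀ t ∈ adom (chase D S), ∃ t' ∈ adom (chase (simpleDB D) (simpleTGDs S)),
      t'.depth = t.depth := by
    rintro t ⟨a, ha, ht⟩
    obtain ⟨α', hr, hin⟩ := chase_forward D S hlin a ha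
    obtain ⟨t', ht', e⟩ := hr.depths t ht
    exact ⟨t', ⟨_, hin, ht'⟩, e⟩
  have B : ∀ t' ∈ adom (chase (simpleDB D) (simpleTGDs S)), ∃ t ∈ adom (chase D S),
      t.depth = t'.depth := by
    rintro t' ⟨a, ha, ht⟩
    obtain ⟨α, α', hr, rfl, hin⟩ := chase_backward D S hlin a ha
    obtain ⟨t, ht', e⟩ := hr.depths' t' ht
    exact ⟨t, ⟨_, hin, ht'⟩, e⟩
  have I : (chase D S).Finite ↔ (chase (simpleDB D) (simpleTGDs S)).Finite := by
    rw [finite_iff D S hfin, finite_iff _ _ (simpleTGDs_finite S hfin)]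
    constructor
    · rintro ⟨n, hn⟩
      refine ⟨n, fun t ht => ?_⟩
      obtain ⟨t', ht', e⟩ := B t ht
      exact e ▸ hn t' ht'
    · rintro ⟨n, hn⟩
      refine ⟨n, fun t ht => ?_⟩
      obtain ⟨t', ht', e⟩ := F t ht
      exact e ▸ hn t' ht'
  refine ⟨I, ?_⟩
  unfold maxdepth
  by_cases hc : (chase D S).Finite
  · rw [if_pos hc, if_pos (I.mp hc)]
    apply le_antisymm
    · refine iSup₂_le fun t ht => ?_
      obtain ⟨t', ht', e⟩ := F t ht
      exact le_iSup₂_of_le t' ht' (by rw [e])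
    · refine iSup₂_le fun t ht => ?_
      obtain ⟨t', ht', e⟩ := B t ht
      exact le_iSup₂_of_le t' ht' (by rw [e])
  · rw [if_neg hc, if_neg (fun h => hc (I.mpr h))]
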